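/- arXiv:1008.0620 — 9 statements merged into one kernel-verified Lean document; each statement's English description precedes it below -/
import Mathlib

section
/- Let (a_k)_{k\in\mathbb{N}} be a square-summable real sequence, (\sigma_k)_{k\in\mathbb{N}} a bounded sequence of positive reals, q_0 > 0 and 0 < q < 1, and set \alpha_n = q_0 q^n and e_n = \big(\sum_{k} (\alpha_n/(\sigma_k^2+\alpha_n))^2 a_k^2\big)^{1/2} for n \in \mathbb{N}. Assume there exist constants \gamma > 0, 0 < \nu < 1, and 0 < C_{\gamma,\nu} \le D_{\gamma,\nu} such that C_{\gamma,\nu}^2 t^{2\nu} \le \sum_{\{k : \sigma_k^2 \le t\}} a_k^2 \le D_{\gamma,\nu}^2 t^{2\nu} for all 0 < t \le \gamma. Then there exists a constant w_1 with 0 < w_1 < 1 such that e_{n+1} \le w_1\, e_n for all n \in \mathbb{N}. -/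
/-- The Tikhonov filter contracts by a fixed factor away from small `s` when `α` is replaced
by `q * α`. -/
lemma tikhonov_filter_le {q d s α : ℝ} (hq : 0 < q) (hq1 : q < 1) (hd : 0 < d) (hα : 0 < α)
    (hs : d * α ≤ s) :
    q * α / (s + q * α) ≤ q * (d + 1) / (d + q) * (α / (s + α)) := by
  have hs0 : 0 < s := lt_of_lt_of_le (by positivity) hs
  rw [div_mul_div_comm, div_le_div_iff₀ (by positivity) (by positivity)]
  have h : 0 ≤ q * α * ((1 - q) * (s - d * α)) :=
    mul_nonneg (by positivity) (mul_nonneg (by linarith) (by linarith))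
  nlinarith [h]

/-- The Tikhonov filter is monotone in the regularization parameter. -/
lemma tikhonov_filter_mono {q s α : ℝ} (hq : 0 < q) (hq1 : q < 1) (hs : 0 < s) (hα : 0 < α) :
    q * α / (s + q * α) ≤ α / (s + α) := by
  rw [div_le_div_iff₀ (by positivity) (by positivity)]
  have h : 0 ≤ α * ((1 - q) * s) := mul_nonneg hα.le (mul_nonneg (by linarith) hs.le)
  nlinarith [h]

/-- One-step contraction of the squared Tikhonov error, provided the coefficients with
`s k ≤ u` carry at most half of the mass of those with `s k ≤ v`. -/
lemma tikhonov_sq_error_step {a s : ℕ → ℝ} (ha : Summable fun k => a k ^ 2)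
    (hs : ∀ k, 0 < s k) {q d α u v : ℝ} (hq : 0 < q) (hq1 : q < 1) (hd : 0 < d) (hα : 0 < α)
    (hu : d * α ≤ u) (hv : v ≤ α)
    (hmass : 2 * (∑' k : {k : ℕ // s k ≤ u}, a (k : ℕ) ^ 2) ≤
      ∑' k : {k : ℕ // s k ≤ v}, a (k : ℕ) ^ 2) :
    (∑' k, (q * α / (s k + q * α)) ^ 2 * a k ^ 2) ≤
      (1 - (1 - (q * (d + 1) / (d + q)) ^ 2) / 5) *
        ∑' k, (α / (s k + α)) ^ 2 * a k ^ 2 := by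
  set r := q * (d + 1) / (d + q) with hr
  have hr0 : 0 < r := by positivity
  have hr1 : r < 1 := by rw [hr, div_lt_one (by positivity)]; nlinarith
  have hr2 : r ^ 2 < 1 := by nlinarith
  set F : ℕ → ℝ := fun k => (α / (s k + α)) ^ 2 * a k ^ 2 with hF
  set G : ℕ → ℝ := fun k => (q * α / (s k + q * α)) ^ 2 * a k ^ 2 with hG
  set A : ℕ → ℝ := Set.indicator {k | s k ≤ u} fun k => a k ^ 2 with hA
  set B : ℕ → ℝ := Set.indicator {k | s k ≤ v} fun k => a k ^ 2 with hB
  set P : ℕ → ℝ := Set.indicator {k | s k ≤ u}ᶜ F with hP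
  have hAt : (∑' k : {k : ℕ // s k ≤ u}, a (k : ℕ) ^ 2) = ∑' k, A k :=
    tsum_subtype {k | s k ≤ u} fun k => a k ^ 2
  have hBt : (∑' k : {k : ℕ // s k ≤ v}, a (k : ℕ) ^ 2) = ∑' k, B k :=
    tsum_subtype {k | s k ≤ v} fun k => a k ^ 2
  have hF0 : ∀ k, 0 ≤ F k := fun k => by positivity
  have hfa : ∀ k, F k ≤ a k ^ 2 := fun k => by
    have h1 : α / (s k + α) ≤ 1 := by
      rw [div_le_one (add_pos (hs k) hα)]; linarith [hs k]
    have h0 : 0 ≤ α / (s k + α) := (div_pos hα (add_pos (hs k) hα)).le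
    exact mul_le_of_le_one_left (sq_nonneg _) (pow_le_one₀ h0 h1)
  have hGF : ∀ k, G k ≤ F k := fun k => by
    have h0 : 0 ≤ q * α / (s k + q * α) :=
      (div_pos (by positivity) (add_pos (hs k) (by positivity))).le
    exact mul_le_mul_of_nonneg_right
      (pow_le_pow_left₀ h0 (tikhonov_filter_mono hq hq1 (hs k) hα) 2) (sq_nonneg _)
  have hFs : Summable F := Summable.of_nonneg_of_le hF0 hfa ha
  have hGs : Summable G := Summable.of_nonneg_of_le (fun k => by positivity) hGF hFs
  have hAs : Summable A := ha.indicator _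
  have hBs : Summable B := ha.indicator _
  have hPs : Summable P := hFs.indicator _
  have h1 : ∑' k, F k ≤ ∑' k, A k + ∑' k, P k := by
    rw [← hAs.tsum_add hPs]
    refine hFs.tsum_le_tsum (fun k => ?_) (hAs.add hPs)
    by_cases hk : s k ≤ u <;> simp [hA, hP, hk, hfa k]
  have h2 : ∑' k, B k ≤ ∑' k, A k + 4 * ∑' k, P k := by
    rw [← tsum_mul_left, ← hAs.tsum_add (hPs.mul_left 4)]
    refine hBs.tsum_le_tsum (fun k => ?_) (hAs.add (hPs.mul_left 4))
    by_cases hk : s k ≤ u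
    · by_cases hk' : s k ≤ v <;> simp [hA, hB, hP, hk, hk', sq_nonneg]
    · by_cases hk' : s k ≤ v
      · have hhalf : 1 / 2 ≤ α / (s k + α) := by
          rw [div_le_div_iff₀ (by norm_num) (add_pos (hs k) hα)]; linarith
        have h4 : 1 ≤ 4 * (α / (s k + α)) ^ 2 := by nlinarith
        have h5 := mul_le_mul_of_nonneg_right h4 (sq_nonneg (a k))
        simp only [hA, hB, hP, hF, Set.indicator, Set.mem_ofPred_eq, Set.mem_compl_iff, hk, hk',
          if_true, if_false, not_false_eq_true]
        linarith
      · simpa [hA, hB, hP, Set.indicator, hk, hk'] using hF0 k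
  have h3 : ∑' k, G k ≤ ∑' k, F k - (1 - r ^ 2) * ∑' k, P k := by
    rw [← tsum_mul_left, ← hFs.tsum_sub (hPs.mul_left _)]
    refine hGs.tsum_le_tsum (fun k => ?_) (hFs.sub (hPs.mul_left _))
    by_cases hk : s k ≤ u
    · simpa [hP, Set.indicator, hk] using hGF k
    · have h0 : 0 ≤ q * α / (s k + q * α) :=
        (div_pos (by positivity) (add_pos (hs k) (by positivity))).le
      have h4 := mul_le_mul_of_nonneg_right
        (pow_le_pow_left₀ h0
          (tikhonov_filter_le hq hq1 hd hα (hu.trans (not_le.mp hk).le)) 2) (sq_nonneg (a k))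
      simp only [hP, hF, hG, Set.indicator, Set.mem_ofPred_eq, Set.mem_compl_iff, hk,
        if_true, not_false_eq_true]
      rw [← hr, mul_pow] at h4
      linarith
  rw [hAt, hBt] at hmass
  have h5 : ∑' k, F k ≤ 5 * ∑' k, P k := by linarith
  have h6 := mul_le_mul_of_nonneg_left h5 (sub_pos.mpr hr2).le
  linarith


/-- For Tikhonov regularization with regularization parameters
`αₙ = q₀ qⁿ`, if the coefficients `aₖ` of the solution satisfy the two-sided tail
condition `C² t^(2ν) ≤ ∑_{σₖ² ≤ t} aₖ² ≤ D² t^(2ν)` for `0 < t ≤ γ`, then the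
noise-free approximation errors `eₙ` decay geometrically:
there is `0 < w₁ < 1` with `e_{n+1} ≤ w₁ eₙ` for all `n`. -/
theorem tikhonov_error_geometric_decay
    (a : ℕ → ℝ) (ha : Summable fun k => a k ^ 2)
    (σ : ℕ → ℝ) (hσpos : ∀ k, 0 < σ k) (hσbdd : ∃ M : ℝ, ∀ k, σ k ≤ M)
    (q0 q : ℝ) (hq0 : 0 < q0) (hq : 0 < q) (hq1 : q < 1)
    (αn : ℕ → ℝ) (hαn : ∀ n, αn n = q0 * q ^ n)
    (e : ℕ → ℝ)
    (he : ∀ n, e n = Real.sqrt (∑' k, (αn n / (σ k ^ 2 + αn n)) ^ 2 * a k ^ 2))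
    (γ ν C D : ℝ) (hγ : 0 < γ) (hν0 : 0 < ν) (hν1 : ν < 1)
    (hC : 0 < C) (hCD : C ≤ D)
    (htail : ∀ t : ℝ, 0 < t → t ≤ γ →
      C ^ 2 * t ^ (2 * ν) ≤ (∑' k : {k : ℕ // σ k ^ 2 ≤ t}, a (k : ℕ) ^ 2) ∧
      (∑' k : {k : ℕ // σ k ^ 2 ≤ t}, a (k : ℕ) ^ 2) ≤ D ^ 2 * t ^ (2 * ν)) :
    ∃ w1 : ℝ, 0 < w1 ∧ w1 < 1 ∧ ∀ n, e (n + 1) ≤ w1 * e n := by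
  have hD : 0 < D := hC.trans_le hCD
  obtain ⟨c, hc⟩ : ∃ c : ℝ, c = (C ^ 2 / (2 * D ^ 2)) ^ (1 / (2 * ν)) := ⟨_, rfl⟩
  have hx0 : 0 < C ^ 2 / (2 * D ^ 2) := by positivity
  have hx1 : C ^ 2 / (2 * D ^ 2) < 1 := by
    rw [div_lt_one (by positivity)]; nlinarith
  have hc0 : 0 < c := hc ▸ Real.rpow_pos_of_pos hx0 _
  have hc1 : c < 1 := hc ▸ Real.rpow_lt_one hx0.le hx1 (by positivity)
  have hcν : c ^ (2 * ν) = C ^ 2 / (2 * D ^ 2) := by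
    rw [hc, ← Real.rpow_mul hx0.le, one_div_mul_cancel (by positivity), Real.rpow_one]
  set m := min 1 (γ / q0) with hm
  have hm0 : 0 < m := lt_min one_pos (by positivity)
  have hd : 0 < c * m := by positivity
  set r := q * (c * m + 1) / (c * m + q) with hr
  have hr0 : 0 < r := by positivity
  have hr1 : r < 1 := by rw [hr, div_lt_one (by positivity)]; nlinarith
  have hr2 : r ^ 2 < 1 := by nlinarith
  have hw0 : 0 < 1 - (1 - r ^ 2) / 5 := by nlinarith [sq_nonneg r]
  refine ⟨Real.sqrt (1 - (1 - r ^ 2) / 5), Real.sqrt_pos.mpr hw0, ?_, fun n => ?_⟩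
  · rw [Real.sqrt_lt' one_pos]; linarith
  have hα : 0 < αn n := by rw [hαn]; positivity
  have hαq : αn (n + 1) = q * αn n := by rw [hαn, hαn]; ring
  have hα0 : αn n ≤ q0 := by
    rw [hαn]; exact mul_le_of_le_one_right hq0.le (pow_le_one₀ hq.le hq1.le)
  rw [he, he, ← Real.sqrt_mul hw0.le, hαq]
  apply Real.sqrt_le_sqrt
  have hβ0 : 0 < min (αn n) γ := lt_min hα hγ
  have hβ : m * αn n ≤ min (αn n) γ := by
    refine le_min (mul_le_of_le_one_left hα.le (min_le_left _ _)) ?_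
    calc m * αn n ≤ γ / q0 * q0 :=
          mul_le_mul (min_le_right _ _) hα0 hα.le (by positivity)
      _ = γ := div_mul_cancel₀ _ hq0.ne'
  refine tikhonov_sq_error_step (u := c * min (αn n) γ) (v := min (αn n) γ) ha
    (fun k => pow_pos (hσpos k) 2) hq hq1 hd hα ?_ (min_le_left _ _) ?_
  · rw [mul_assoc]; exact mul_le_mul_of_nonneg_left hβ hc0.le
  · have hlow := (htail _ hβ0 (min_le_right _ _)).1
    have hup := (htail _ (mul_pos hc0 hβ0)
      ((mul_le_of_le_one_left hβ0.le hc1.le).trans (min_le_right _ _))).2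
    rw [Real.mul_rpow hc0.le hβ0.le, hcν] at hup
    have hX : D ^ 2 * (C ^ 2 / (2 * D ^ 2) * min (αn n) γ ^ (2 * ν)) =
        C ^ 2 * min (αn n) γ ^ (2 * ν) / 2 := by field_simp
    linarith
end

section
/- Under the balancing setup with deterministic noise, for every integer k \ge 1 and every n \ge n_{opt}+1 one has b_k(n) \le 1, i.e. \|x_n^\delta - x_m^\delta\| \le 4\rho(m) for all m with n < m \le n+k. Consequently, for every \tau > 1 the fast balancing parameter n_*(\tau) exists and satisfies n_*(\tau) \le n_{opt} + 1. -/
/-- In the balancing setup with deterministic noise, for every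
`n ≥ n_opt + 1` one has `‖xₙᵟ - xₘᵟ‖ ≤ 4 ρ(m)` for all `n < m ≤ n + k`
(i.e. `b_k(n) ≤ 1`); consequently, for every `τ > 1` the fast balancing parameter
`n_*(τ)` exists and satisfies `n_*(τ) ≤ n_opt + 1`. -/
theorem fast_balancing_exists_and_le
    {H : Type*} [NormedAddCommGroup H] [InnerProductSpace ℝ H] [CompleteSpace H]
    (x : H) (xs xδ : ℕ → H) (ρ : ℕ → ℝ) (hρpos : ∀ n, 0 < ρ n)
    (w1 w2 : ℝ) (hw10 : 0 < w1) (hw11 : w1 < 1) (hw2 : 1 < w2)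
    (hdec : ∀ n, ‖x - xs (n + 1)‖ ≤ w1 * ‖x - xs n‖)
    (hρmono : ∀ n, ρ n ≤ ρ (n + 1)) (hρgrow : ∀ n, ρ (n + 1) ≤ w2 * ρ n)
    (nopt : ℕ)
    (hopt1 : ρ nopt < ‖xs nopt - x‖)
    (hopt2 : ‖xs (nopt + 1) - x‖ ≤ ρ (nopt + 1))
    (hnoise : ∀ n, ‖xδ n - xs n‖ ≤ ρ n)
    (k : ℕ) (hk : 1 ≤ k)
    (b : ℕ → ℝ)
    (hb : ∀ n, IsGreatest
      ((fun m => ‖xδ n - xδ m‖ / (4 * ρ m)) '' Set.Ioc n (n + k)) (b n)) :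
    (∀ n, nopt + 1 ≤ n → ∀ m, n < m → m ≤ n + k → ‖xδ n - xδ m‖ ≤ 4 * ρ m) ∧
    (∀ τ : ℝ, 1 < τ → ∃ ns : ℕ, IsLeast {n | b n < τ} ns ∧ ns ≤ nopt + 1) := by
  have hmono : Monotone ρ := monotone_nat_of_le_succ hρmono
  have happrox : ∀ n, nopt + 1 ≤ n → ‖xs n - x‖ ≤ ρ n := by
    intro n hn
    induction n, hn using Nat.le_induction with
    | base => exact hopt2
    | succ n _ ih =>
      have h := hdec n
      rw [norm_sub_rev x, norm_sub_rev x] at h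
      calc ‖xs (n + 1) - x‖ ≤ w1 * ‖xs n - x‖ := h
        _ ≤ ‖xs n - x‖ := mul_le_of_le_one_left (norm_nonneg _) hw11.le
        _ ≤ ρ (n + 1) := ih.trans (hρmono n)
  have herr : ∀ n, nopt + 1 ≤ n → ‖xδ n - x‖ ≤ 2 * ρ n := by
    intro n hn
    linarith [norm_sub_le_norm_sub_add_norm_sub (xδ n) (xs n) x, hnoise n, happrox n hn]
  have hbound : ∀ n, nopt + 1 ≤ n → ∀ m, n < m → m ≤ n + k →
      ‖xδ n - xδ m‖ ≤ 4 * ρ m := by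
    intro n hn m hnm _
    have hm := herr m (hn.trans hnm.le)
    rw [norm_sub_rev] at hm
    linarith [norm_sub_le_norm_sub_add_norm_sub (xδ n) x (xδ m), herr n hn, hmono hnm.le]
  refine ⟨hbound, fun τ hτ => ?_⟩
  have hmem : nopt + 1 ∈ {n | b n < τ} := by
    obtain ⟨m, hm, hbm⟩ := (hb (nopt + 1)).1
    have hle : b (nopt + 1) ≤ 1 := by
      rw [← hbm]
      exact div_le_one_of_le₀ (hbound _ le_rfl m hm.1 hm.2)
        (mul_pos four_pos (hρpos m)).le
    exact hle.trans_lt hτ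
  exact ⟨sInf {n | b n < τ}, ⟨Nat.sInf_mem ⟨_, hmem⟩, fun _ h => Nat.sInf_le h⟩,
    Nat.sInf_le hmem⟩
end

section
/- Under the balancing setup with deterministic noise, let k \ge 1 be an integer, \tau \ge 1, and let n \in \mathbb{N} satisfy b_k(n) < \tau. Then \|x_n - x\| \le (4\tau + 2)\, \min_{1 \le \kappa \le k} \Big\{ \frac{w_2^{\kappa}}{1 - w_1^{\kappa}} \Big\}\, \rho(n). -/
/-- Iterating a one-step growth bound `u (i + 1) ≤ c * u i`. -/
theorem le_pow_mul_of_succ_le_mul {u : ℕ → ℝ} {c : ℝ} (hc : 0 ≤ c)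
    (hu : ∀ i, u (i + 1) ≤ c * u i) (n j : ℕ) : u (n + j) ≤ c ^ j * u n := by
  induction j with
  | zero => simp
  | succ j ih =>
    calc u (n + j + 1) ≤ c * u (n + j) := hu _
      _ ≤ c * (c ^ j * u n) := by gcongr
      _ = c ^ (j + 1) * u n := by ring

/-- In the balancing setup with deterministic noise, if the balancing
functional satisfies `b_k(n) < τ`, then
`‖xₙ - x‖ ≤ (4τ + 2) · min_{1 ≤ κ ≤ k} { w₂^κ / (1 - w₁^κ) } · ρ(n)`. -/
theorem balancing_functional_small_implies_error_bound
    {H : Type*} [NormedAddCommGroup H] [InnerProductSpace ℝ H] [CompleteSpace H]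
    (x : H) (xs xδ : ℕ → H) (ρ : ℕ → ℝ) (hρpos : ∀ n, 0 < ρ n)
    (w1 w2 : ℝ) (hw10 : 0 < w1) (hw11 : w1 < 1) (hw2 : 1 < w2)
    (hdec : ∀ n, ‖x - xs (n + 1)‖ ≤ w1 * ‖x - xs n‖)
    (hρmono : ∀ n, ρ n ≤ ρ (n + 1)) (hρgrow : ∀ n, ρ (n + 1) ≤ w2 * ρ n)
    (hnoise : ∀ n, ‖xδ n - xs n‖ ≤ ρ n)
    (k : ℕ) (hk : 1 ≤ k)
    (b : ℕ → ℝ)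
    (hb : ∀ n, IsGreatest
      ((fun m => ‖xδ n - xδ m‖ / (4 * ρ m)) '' Set.Ioc n (n + k)) (b n))
    (τ : ℝ) (hτ : 1 ≤ τ) (n : ℕ) (hbn : b n < τ) :
    ‖xs n - x‖ ≤ (4 * τ + 2) *
      ((Finset.Icc 1 k).inf' (Finset.nonempty_Icc.mpr hk)
        fun κ => w2 ^ κ / (1 - w1 ^ κ)) * ρ n := by
  obtain ⟨κ, hκ, hmin⟩ := Finset.exists_mem_eq_inf' (Finset.nonempty_Icc.mpr hk)
    fun κ => w2 ^ κ / (1 - w1 ^ κ)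
  rw [hmin]
  obtain ⟨hκ1, hκk⟩ := Finset.mem_Icc.mp hκ
  have hw1κ : 0 < 1 - w1 ^ κ := sub_pos.mpr (pow_lt_one₀ hw10.le hw11 (by omega))
  have herr : ‖x - xs (n + κ)‖ ≤ w1 ^ κ * ‖x - xs n‖ :=
    le_pow_mul_of_succ_le_mul (u := fun i => ‖x - xs i‖) hw10.le hdec n κ
  have hρκ : ρ (n + κ) ≤ w2 ^ κ * ρ n :=
    le_pow_mul_of_succ_le_mul (by linarith) hρgrow n κ
  have hρle : ρ n ≤ ρ (n + κ) := monotone_nat_of_le_succ hρmono (Nat.le_add_right n κ)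
  have hbal : ‖xδ n - xδ (n + κ)‖ ≤ τ * (4 * ρ (n + κ)) := by
    have hmem : n + κ ∈ Set.Ioc n (n + k) := ⟨by omega, by omega⟩
    have hle := ((hb n).2 (Set.mem_image_of_mem _ hmem)).trans hbn.le
    exact (div_le_iff₀ (mul_pos four_pos (hρpos _))).mp hle
  have htri : ‖x - xs n‖ ≤ ‖x - xs (n + κ)‖ + ‖xδ (n + κ) - xs (n + κ)‖
      + ‖xδ n - xδ (n + κ)‖ + ‖xδ n - xs n‖ := by
    calc ‖x - xs n‖ = ‖(x - xs (n + κ)) - (xδ (n + κ) - xs (n + κ))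
          - (xδ n - xδ (n + κ)) + (xδ n - xs n)‖ := by congr 1; abel
      _ ≤ _ := (norm_add_le _ _).trans <| by
        gcongr
        exact (norm_sub_le _ _).trans <| by
          gcongr
          exact norm_sub_le _ _
  have hfactor : (4 * τ + 2) * ρ (n + κ) ≤ (4 * τ + 2) * (w2 ^ κ * ρ n) := by gcongr
  rw [norm_sub_rev, show (4 * τ + 2) * (w2 ^ κ / (1 - w1 ^ κ)) * ρ n
    = (4 * τ + 2) * (w2 ^ κ * ρ n) / (1 - w1 ^ κ) by ring, le_div_iff₀ hw1κ]
  linarith [hnoise n, hnoise (n + κ)]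
end

section
/- Oracle inequality for fast balancing, deterministic case: under the balancing setup with deterministic noise, for every integer k \ge 1 and every \tau > 1 the fast balancing parameter n_* = n_*(\tau) exists and satisfies \|x_{n_*}^\delta - x\| \le C\,\big( \|x_{n_{opt}} - x\| + \rho(n_{opt}) \big), where C = \frac{(4\tau+3)\,w_2}{2} \min_{1\le\kappa\le k} \Big\{ \frac{w_2^{\kappa}}{1 - w_1^{\kappa}} \Big\}; in particular C depends only on w_1, w_2, k and \tau and not on the noise level. -/
/-- Oracle inequality for fast balancing in the deterministic case:
for every `τ > 1` the fast balancing parameter `n_* = n_*(τ)` exists and satisfies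
`‖x_{n_*}ᵟ - x‖ ≤ C (‖x_{n_opt} - x‖ + ρ(n_opt))` with
`C = ((4τ+3) w₂ / 2) · min_{1 ≤ κ ≤ k} { w₂^κ / (1 - w₁^κ) }`. -/
theorem fast_balancing_oracle_deterministic
    {H : Type*} [NormedAddCommGroup H] [InnerProductSpace ℝ H] [CompleteSpace H]
    (x : H) (xs xδ : ℕ → H) (ρ : ℕ → ℝ) (hρpos : ∀ n, 0 < ρ n)
    (w1 w2 : ℝ) (hw10 : 0 < w1) (hw11 : w1 < 1) (hw2 : 1 < w2)
    (hdec : ∀ n, ‖x - xs (n + 1)‖ ≤ w1 * ‖x - xs n‖)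
    (hρmono : ∀ n, ρ n ≤ ρ (n + 1)) (hρgrow : ∀ n, ρ (n + 1) ≤ w2 * ρ n)
    (nopt : ℕ)
    (hopt1 : ρ nopt < ‖xs nopt - x‖)
    (hopt2 : ‖xs (nopt + 1) - x‖ ≤ ρ (nopt + 1))
    (hnoise : ∀ n, ‖xδ n - xs n‖ ≤ ρ n)
    (k : ℕ) (hk : 1 ≤ k)
    (b : ℕ → ℝ)
    (hb : ∀ n, IsGreatest
      ((fun m => ‖xδ n - xδ m‖ / (4 * ρ m)) '' Set.Ioc n (n + k)) (b n)) :
    ∀ τ : ℝ, 1 < τ → ∃ ns : ℕ, IsLeast {n | b n < τ} ns ∧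
      ‖xδ ns - x‖ ≤ ((4 * τ + 3) * w2 / 2) *
        ((Finset.Icc 1 k).inf' (Finset.nonempty_Icc.mpr hk)
          fun κ => w2 ^ κ / (1 - w1 ^ κ)) *
        (‖xs nopt - x‖ + ρ nopt) := by
  have hmono : Monotone ρ := monotone_nat_of_le_succ hρmono
  have hgrow_pow : ∀ n j, ρ (n + j) ≤ w2 ^ j * ρ n := by
    intro n j
    induction j with
    | zero => simp
    | succ j ih =>
      calc ρ (n + (j + 1)) ≤ w2 * ρ (n + j) := hρgrow (n + j)
        _ ≤ w2 * (w2 ^ j * ρ n) := by gcongr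
        _ = w2 ^ (j + 1) * ρ n := by ring
  have hdec_pow : ∀ n j, ‖x - xs (n + j)‖ ≤ w1 ^ j * ‖x - xs n‖ := by
    intro n j
    induction j with
    | zero => simp
    | succ j ih =>
      calc ‖x - xs (n + (j + 1))‖ ≤ w1 * ‖x - xs (n + j)‖ := hdec (n + j)
        _ ≤ w1 * (w1 ^ j * ‖x - xs n‖) := by gcongr
        _ = w1 ^ (j + 1) * ‖x - xs n‖ := by ring
  have herr : ∀ n, nopt + 1 ≤ n → ‖x - xs n‖ ≤ ρ n := by
    intro n hn
    induction n, hn using Nat.le_induction with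
    | base => rwa [norm_sub_rev]
    | succ n _ ih =>
      have h := hdec n
      nlinarith [norm_nonneg (x - xs n), hρmono n]
  intro τ hτ
  have hbopt : b (nopt + 1) < τ := by
    obtain ⟨m, ⟨hm, -⟩, hbm⟩ := (hb (nopt + 1)).1
    rw [← hbm]
    refine lt_of_le_of_lt ?_ hτ
    have hpos := hρpos m
    have htri : ‖xδ (nopt + 1) - xδ m‖ ≤ ‖xδ (nopt + 1) - xs (nopt + 1)‖ +
        ‖x - xs (nopt + 1)‖ + ‖x - xs m‖ + ‖xδ m - xs m‖ := by
      have heq : xδ (nopt + 1) - xδ m = (xδ (nopt + 1) - xs (nopt + 1)) -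
          (x - xs (nopt + 1)) + (x - xs m) - (xδ m - xs m) := by abel
      rw [heq]
      refine (norm_sub_le _ _).trans (add_le_add_left ?_ _)
      exact (norm_add_le _ _).trans (add_le_add_left (norm_sub_le _ _) _)
    rw [div_le_one (by positivity)]
    linarith [hnoise (nopt + 1), hnoise m, herr (nopt + 1) le_rfl, herr m hm.le, hmono hm.le]
  classical
  have hex : ∃ n, b n < τ := ⟨_, hbopt⟩
  refine ⟨Nat.find hex, ⟨Nat.find_spec hex, fun n hn => Nat.find_min' hex hn⟩, ?_⟩
  have hle : Nat.find hex ≤ nopt + 1 := Nat.find_min' hex hbopt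
  have hspec := Nat.find_spec hex
  generalize Nat.find hex = n at hle hspec
  obtain ⟨κ, hκ, hmin⟩ := Finset.exists_mem_eq_inf' (Finset.nonempty_Icc.mpr hk)
    (fun κ => w2 ^ κ / (1 - w1 ^ κ))
  rw [hmin]
  obtain ⟨hκ1, hκk⟩ := Finset.mem_Icc.mp hκ
  have hw1κ : w1 ^ κ < 1 := pow_lt_one₀ hw10.le hw11 (by lia)
  have hw1κ0 : 0 < w1 ^ κ := by positivity
  have hw2κ : 1 ≤ w2 ^ κ := one_le_pow₀ hw2.le
  have hden : 0 < 1 - w1 ^ κ := by linarith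
  have hn := hρpos n
  have hδ : ‖xδ n - xδ (n + κ)‖ ≤ τ * (4 * ρ (n + κ)) := by
    have hpos := hρpos (n + κ)
    rw [← div_le_iff₀ (by positivity)]
    exact ((hb n).2 ⟨n + κ, ⟨by lia, by lia⟩, rfl⟩).trans hspec.le
  have htri : ‖x - xs n‖ ≤ ‖x - xs (n + κ)‖ + ‖xδ (n + κ) - xs (n + κ)‖ +
      ‖xδ n - xδ (n + κ)‖ + ‖xδ n - xs n‖ := by
    have heq : x - xs n = (x - xs (n + κ)) - (xδ (n + κ) - xs (n + κ)) -
        (xδ n - xδ (n + κ)) + (xδ n - xs n) := by abel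
    rw [heq]
    refine (norm_add_le _ _).trans (add_le_add_left ?_ _)
    exact (norm_sub_le _ _).trans (add_le_add_left (norm_sub_le _ _) _)
  have hbias : ‖x - xs n‖ * (1 - w1 ^ κ) ≤ (4 * τ + 1) * (w2 ^ κ * ρ n) + ρ n := by
    have h : (4 * τ + 1) * ρ (n + κ) ≤ (4 * τ + 1) * (w2 ^ κ * ρ n) :=
      mul_le_mul_of_nonneg_left (hgrow_pow n κ) (by linarith)
    linarith [hdec_pow n κ, hnoise n, hnoise (n + κ)]
  have htotal : ‖xδ n - x‖ ≤ ρ n + ‖x - xs n‖ := by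
    have h := norm_sub_le (xδ n - xs n) (x - xs n)
    rw [sub_sub_sub_cancel_right] at h
    linarith [hnoise n]
  have hstep : ‖xδ n - x‖ ≤ (4 * τ + 3) * (w2 ^ κ / (1 - w1 ^ κ)) * ρ n := by
    have h : ρ n ≤ w2 ^ κ * ρ n := le_mul_of_one_le_left hn.le hw2κ
    rw [mul_div_assoc', div_mul_eq_mul_div, le_div_iff₀ hden]
    nlinarith [mul_le_mul_of_nonneg_right htotal hden.le, mul_pos hw1κ0 hn]
  have hρn : ρ n ≤ w2 / 2 * (‖xs nopt - x‖ + ρ nopt) := by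
    nlinarith [hmono hle, hρgrow nopt]
  have hC : 0 ≤ (4 * τ + 3) * (w2 ^ κ / (1 - w1 ^ κ)) :=
    mul_nonneg (by linarith) (by positivity)
  calc ‖xδ n - x‖ ≤ (4 * τ + 3) * (w2 ^ κ / (1 - w1 ^ κ)) * ρ n := hstep
    _ ≤ (4 * τ + 3) * (w2 ^ κ / (1 - w1 ^ κ)) * (w2 / 2 * (‖xs nopt - x‖ + ρ nopt)) :=
      mul_le_mul_of_nonneg_left hρn hC
    _ = _ := by ring
end

section
/- For every w_1 \in (0,1) there exist constants c_1, c_2 > 0 (depending only on w_1, in particular independent of the noise level and of \tau) such that the following holds. Under the stochastic balancing setup, for every \tau \ge 0 and every n < n_{opt}: \mathbb{P}\big( \|x_n^\delta - x_{n+1}^\delta\| < 4\tau\,\rho(n+1) \big) \le c_1 \exp\big(-c_2 (n_{opt}-n)^2\big) \exp(\tau^2); equivalently \mathbb{P}(b_1(n) < \tau) \le c_1 \exp(-c_2 (n_{opt}-n)^2) \exp(\tau^2). -/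
open MeasureTheory

/-- A sequence contracting towards `x` with rate `w` takes a step of size at least
`(1 - w) ^ 2 / w * m * r` at any index that lies `m` steps before an error of size `r`. -/
lemma le_norm_sub_succ_of_contracting {H : Type*} [NormedAddCommGroup H] {w : ℝ} (hw0 : 0 < w)
    (hw1 : w < 1) {x : H} {xs : ℕ → H} (hc : ∀ n, ‖x - xs (n + 1)‖ ≤ w * ‖x - xs n‖)
    (n m : ℕ) {r : ℝ} (hr : 0 ≤ r) (hm : r ≤ ‖x - xs (n + m)‖) :
    (1 - w) ^ 2 / w * m * r ≤ ‖xs n - xs (n + 1)‖ := by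
  have hpow : ∀ k : ℕ, ‖x - xs (n + k)‖ ≤ w ^ k * ‖x - xs n‖ := by
    intro k
    induction k with
    | zero => simp
    | succ k ih =>
      calc ‖x - xs (n + k + 1)‖ ≤ w * ‖x - xs (n + k)‖ := hc _
        _ ≤ w * (w ^ k * ‖x - xs n‖) := by gcongr
        _ = w ^ (k + 1) * ‖x - xs n‖ := by ring
  have hw_inv : 1 ≤ w⁻¹ := (one_le_inv₀ hw0).2 hw1.le
  have hbern := one_add_mul_le_pow (show (-2 : ℝ) ≤ w⁻¹ - 1 by linarith) m
  rw [add_sub_cancel, inv_pow] at hbern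
  have herr : (m * (w⁻¹ - 1)) * r ≤ ‖x - xs n‖ :=
    calc (m * (w⁻¹ - 1)) * r ≤ (w ^ m)⁻¹ * r := by gcongr; linarith
      _ ≤ (w ^ m)⁻¹ * (w ^ m * ‖x - xs n‖) := by gcongr; exact hm.trans (hpow m)
      _ = ‖x - xs n‖ := by field_simp
  have htri : ‖x - xs n‖ - ‖x - xs (n + 1)‖ ≤ ‖xs n - xs (n + 1)‖ := by
    have h := norm_sub_norm_le (x - xs n) (x - xs (n + 1))
    rwa [sub_sub_sub_cancel_left, norm_sub_rev (xs (n + 1))] at h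
  calc (1 - w) ^ 2 / w * m * r = (1 - w) * ((m * (w⁻¹ - 1)) * r) := by field_simp
    _ ≤ (1 - w) * ‖x - xs n‖ := by gcongr
    _ ≤ ‖xs n - xs (n + 1)‖ := by linarith [hc n]

/-- If the distance of `a` and `b` is at least `s * r`, then their perturbations can only be
within `4 * τ * r` of each other if one of the perturbations has size `(s - 4 * τ) / 2 * r`. -/
lemma le_norm_or_le_norm_of_norm_add_sub_add_lt {H : Type*} [NormedAddCommGroup H] {a b u v : H}
    {r s τ : ℝ} (hs : s * r ≤ ‖a - b‖) (h : ‖(a + u) - (b + v)‖ < 4 * τ * r) :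
    (s - 4 * τ) / 2 * r ≤ ‖u‖ ∨ (s - 4 * τ) / 2 * r ≤ ‖v‖ := by
  by_contra! hlt
  have h1 : ‖a - b‖ ≤ ‖(a + u) - (b + v)‖ + ‖u - v‖ := by
    have h2 := norm_sub_le ((a + u) - (b + v)) (u - v)
    rwa [show (a + u) - (b + v) - (u - v) = a - b by abel] at h2
  linarith [norm_sub_le u v, hlt.1, hlt.2]

/-- Early-stopping probability bound: for every `w₁ ∈ (0,1)` there
are constants `c₁, c₂ > 0` depending only on `w₁` such that, in the stochastic
balancing setup, for every `τ ≥ 0` and every `n < n_opt` the probability that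
`‖xₙᵟ - x_{n+1}ᵟ‖ < 4 τ ρ(n+1)` (i.e. `b₁(n) < τ`) is at most
`c₁ exp(-c₂ (n_opt - n)²) exp(τ²)`. -/
theorem early_stopping_probability_bound
    (w1 : ℝ) (hw10 : 0 < w1) (hw11 : w1 < 1) :
    ∃ c1 c2 : ℝ, 0 < c1 ∧ 0 < c2 ∧
      ∀ (H : Type) [NormedAddCommGroup H] [InnerProductSpace ℝ H] [CompleteSpace H]
        [MeasurableSpace H] [BorelSpace H]
        (Ω : Type) [MeasurableSpace Ω] (P : Measure Ω) [IsProbabilityMeasure P]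
        (x : H) (xs : ℕ → H) (η : ℕ → Ω → H) (ρ : ℕ → ℝ) (w2 : ℝ) (nopt : ℕ),
        (∀ n, 0 < ρ n) → 1 < w2 →
        (∀ n, ‖x - xs (n + 1)‖ ≤ w1 * ‖x - xs n‖) →
        (∀ n, ρ n ≤ ρ (n + 1)) → (∀ n, ρ (n + 1) ≤ w2 * ρ n) →
        ρ nopt < ‖xs nopt - x‖ → ‖xs (nopt + 1) - x‖ ≤ ρ (nopt + 1) →
        (∀ n, Measurable (η n)) →
        (∀ n, ∀ t : ℝ, 0 < t →
          P {ω | t * ρ n ≤ ‖η n ω‖} ≤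
            ENNReal.ofReal (Real.sqrt 2 * Real.exp (-t ^ 2 / 4))) →
        ∀ τ : ℝ, 0 ≤ τ → ∀ n, n < nopt →
          P {ω | ‖(xs n + η n ω) - (xs (n + 1) + η (n + 1) ω)‖ < 4 * τ * ρ (n + 1)} ≤
            ENNReal.ofReal
              (c1 * Real.exp (-c2 * ((nopt : ℝ) - (n : ℝ)) ^ 2) * Real.exp (τ ^ 2)) := by
  refine ⟨2 * √2, ((1 - w1) ^ 2 / w1) ^ 2 / 32, by positivity, ?_, ?_⟩
  · have : 0 < 1 - w1 := by linarith
    positivity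
  intro H _ _ _ _ _ Ω _ P _ x xs η ρ w2 nopt hρ _ hc hmono _ hopt _ _ htail τ _ n hn
  obtain ⟨m, rfl⟩ := Nat.exists_eq_add_of_lt hn
  have hρ_mono : Monotone ρ := monotone_nat_of_le_succ hmono
  have hsig := le_norm_sub_succ_of_contracting hw10 hw11 hc n (m + 1) (hρ (n + 1)).le
    (((hρ_mono (by lia)).trans hopt.le).trans_eq (norm_sub_rev _ _))
  have hm : ((n + m + 1 : ℕ) : ℝ) - n = (m + 1 : ℕ) := by push_cast; ring
  rw [hm, mul_assoc (2 * √2), ← Real.exp_add]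
  set s : ℝ := (1 - w1) ^ 2 / w1 * (m + 1 : ℕ) with hs
  have hexp : -(((1 - w1) ^ 2 / w1) ^ 2 / 32) * ((m + 1 : ℕ) : ℝ) ^ 2 + τ ^ 2
      = -s ^ 2 / 32 + τ ^ 2 := by rw [hs]; ring
  rw [hexp]
  have hs0 : 0 ≤ s := by positivity
  rcases le_or_gt s (4 * τ) with hle | hlt
  · refine prob_le_one.trans (ENNReal.one_le_ofReal.2 ?_)
    have h1 : 1 ≤ √2 := Real.one_le_sqrt.2 (by norm_num)
    have h2 : 1 ≤ Real.exp (-s ^ 2 / 32 + τ ^ 2) := Real.one_le_exp (by nlinarith)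
    nlinarith
  have ht : 0 < (s - 4 * τ) / 2 := by linarith
  calc P {ω | ‖(xs n + η n ω) - (xs (n + 1) + η (n + 1) ω)‖ < 4 * τ * ρ (n + 1)}
      ≤ P ({ω | (s - 4 * τ) / 2 * ρ n ≤ ‖η n ω‖} ∪
          {ω | (s - 4 * τ) / 2 * ρ (n + 1) ≤ ‖η (n + 1) ω‖}) :=
        measure_mono fun ω hω => (le_norm_or_le_norm_of_norm_add_sub_add_lt hsig hω).imp_left
          (mul_le_mul_of_nonneg_left (hmono n) ht.le).trans
    _ ≤ _ := (measure_union_le _ _).trans (add_le_add (htail n _ ht) (htail (n + 1) _ ht))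
    _ = ENNReal.ofReal (2 * √2 * Real.exp (-((s - 4 * τ) / 2) ^ 2 / 4)) := by
        rw [← ENNReal.ofReal_add (by positivity) (by positivity)]
        ring_nf
    _ ≤ ENNReal.ofReal (2 * √2 * Real.exp (-s ^ 2 / 32 + τ ^ 2)) := by
        gcongr
        nlinarith [sq_nonneg (s - 8 * τ)]
end

section
/- Under the stochastic balancing setup, for every \tau \ge 0 and every n \ge n_{opt}+1: \mathbb{P}\big( \|x_n^\delta - x_{n+1}^\delta\| \ge 4\tau\,\rho(n+1) \big) \le 2\sqrt{2}\, \exp(-\tau^2/4); equivalently \mathbb{P}(b_1(n) \ge \tau) \le 2\sqrt{2}\exp(-\tau^2/4), with a constant not depending on the noise level, on \tau, or on n. -/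
open MeasureTheory

/-- If the approximation error contracts and the noise level increases, then once the
approximation error is dominated by the noise level it stays so. -/
theorem norm_sub_le_of_contracting {H : Type*} [SeminormedAddCommGroup H] {x : H} {xs : ℕ → H}
    {ρ : ℕ → ℝ} {w : ℝ} (hw : w ≤ 1) (hdec : ∀ n, ‖x - xs (n + 1)‖ ≤ w * ‖x - xs n‖)
    (hρ : ∀ n, ρ n ≤ ρ (n + 1)) {m n : ℕ} (hm : ‖x - xs m‖ ≤ ρ m) (hmn : m ≤ n) :
    ‖x - xs n‖ ≤ ρ n := by
  induction n, hmn using Nat.le_induction with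
  | base => exact hm
  | succ k _ ih =>
    calc ‖x - xs (k + 1)‖ ≤ w * ‖x - xs k‖ := hdec k
      _ ≤ ‖x - xs k‖ := mul_le_of_le_one_left (norm_nonneg _) hw
      _ ≤ ρ (k + 1) := ih.trans (hρ k)

theorem one_le_two_mul_sqrt_two_mul_exp {τ : ℝ} (h0 : 0 ≤ τ) (h1 : τ ≤ 1) :
    1 ≤ 2 * Real.sqrt 2 * Real.exp (-τ ^ 2 / 4) := by
  have hsqrt : 1 ≤ Real.sqrt 2 := Real.one_le_sqrt.mpr one_le_two
  have hexp : 1 / 2 ≤ Real.exp (-τ ^ 2 / 4) := by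
    nlinarith [Real.add_one_le_exp (-τ ^ 2 / 4)]
  nlinarith

/-- If two perturbed elements are at distance at least `4 τ r` with `1 ≤ τ`, while the unperturbed
ones are within `s ≤ r` and `r` of a common point, then one of the perturbations is large. -/
theorem le_norm_or_le_norm_of_le_norm_add_sub_add {H : Type*} [SeminormedAddCommGroup H]
    {x a b u v : H} {r s τ : ℝ} (hs : 0 ≤ s) (hsr : s ≤ r) (hτ : 1 ≤ τ)
    (ha : ‖x - a‖ ≤ s) (hb : ‖x - b‖ ≤ r) (h : 4 * τ * r ≤ ‖(a + u) - (b + v)‖) :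
    τ * s ≤ ‖u‖ ∨ τ * r ≤ ‖v‖ := by
  by_contra! hlt
  have htri : ‖(a + u) - (b + v)‖ ≤ ‖x - b‖ + ‖x - a‖ + (‖u‖ + ‖v‖) := by
    calc ‖(a + u) - (b + v)‖ = ‖((x - b) - (x - a)) + (u - v)‖ := by congr 1; abel
      _ ≤ _ := (norm_add_le _ _).trans (add_le_add (norm_sub_le _ _) (norm_sub_le _ _))
  nlinarith [mul_le_mul_of_nonneg_left hsr (zero_le_one.trans hτ),
    mul_le_mul_of_nonneg_right hτ (hs.trans hsr)]

/-- Late-stopping probability bound: in the stochastic balancing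
setup, for every `τ ≥ 0` and every `n ≥ n_opt + 1`, the probability that
`‖xₙᵟ - x_{n+1}ᵟ‖ ≥ 4 τ ρ(n+1)` (i.e. `b₁(n) ≥ τ`) is at most `2√2 exp(-τ²/4)`. -/
theorem late_stopping_probability_bound
    {H : Type*} [NormedAddCommGroup H] [InnerProductSpace ℝ H] [CompleteSpace H]
    [MeasurableSpace H] [BorelSpace H]
    {Ω : Type*} [MeasurableSpace Ω] (P : Measure Ω) [IsProbabilityMeasure P]
    (x : H) (xs : ℕ → H) (η : ℕ → Ω → H) (ρ : ℕ → ℝ) (hρpos : ∀ n, 0 < ρ n)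
    (w1 w2 : ℝ) (hw10 : 0 < w1) (hw11 : w1 < 1) (hw2 : 1 < w2)
    (hdec : ∀ n, ‖x - xs (n + 1)‖ ≤ w1 * ‖x - xs n‖)
    (hρmono : ∀ n, ρ n ≤ ρ (n + 1)) (hρgrow : ∀ n, ρ (n + 1) ≤ w2 * ρ n)
    (nopt : ℕ)
    (hopt1 : ρ nopt < ‖xs nopt - x‖)
    (hopt2 : ‖xs (nopt + 1) - x‖ ≤ ρ (nopt + 1))
    (hηmeas : ∀ n, Measurable (η n))
    (htail : ∀ n, ∀ t : ℝ, 0 < t →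
      P {ω | t * ρ n ≤ ‖η n ω‖} ≤
        ENNReal.ofReal (Real.sqrt 2 * Real.exp (-t ^ 2 / 4))) :
    ∀ τ : ℝ, 0 ≤ τ → ∀ n, nopt + 1 ≤ n →
      P {ω | 4 * τ * ρ (n + 1) ≤ ‖(xs n + η n ω) - (xs (n + 1) + η (n + 1) ω)‖} ≤
        ENNReal.ofReal (2 * Real.sqrt 2 * Real.exp (-τ ^ 2 / 4)) := by
  intro τ hτ n hn
  rcases le_total τ 1 with h1 | h1
  · exact prob_le_one.trans
      (ENNReal.one_le_ofReal.mpr (one_le_two_mul_sqrt_two_mul_exp hτ h1))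
  have happrox : ∀ m, nopt + 1 ≤ m → ‖x - xs m‖ ≤ ρ m := fun m hm =>
    norm_sub_le_of_contracting hw11.le hdec hρmono (norm_sub_rev x _ ▸ hopt2) hm
  have hτ0 : 0 < τ := zero_lt_one.trans_le h1
  calc P {ω | 4 * τ * ρ (n + 1) ≤ ‖(xs n + η n ω) - (xs (n + 1) + η (n + 1) ω)‖}
      ≤ P ({ω | τ * ρ n ≤ ‖η n ω‖} ∪ {ω | τ * ρ (n + 1) ≤ ‖η (n + 1) ω‖}) :=
        measure_mono fun ω hω => le_norm_or_le_norm_of_le_norm_add_sub_add (hρpos n).le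
          (hρmono n) h1 (happrox n hn) (happrox (n + 1) (Nat.le_succ_of_le hn)) hω
    _ ≤ P {ω | τ * ρ n ≤ ‖η n ω‖} + P {ω | τ * ρ (n + 1) ≤ ‖η (n + 1) ω‖} :=
        measure_union_le _ _
    _ ≤ ENNReal.ofReal (Real.sqrt 2 * Real.exp (-τ ^ 2 / 4)) +
          ENNReal.ofReal (Real.sqrt 2 * Real.exp (-τ ^ 2 / 4)) :=
        add_le_add (htail n τ hτ0) (htail (n + 1) τ hτ0)
    _ = ENNReal.ofReal (2 * Real.sqrt 2 * Real.exp (-τ ^ 2 / 4)) := by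
        rw [← ENNReal.ofReal_add (by positivity) (by positivity)]
        ring_nf
end

section
/- For every w_1 \in (0,1) there exist constants c_1, c_2 > 0 depending only on w_1 such that the following holds. Under the stochastic balancing setup, let \tau \ge 0 and let n_* = n_*(\tau) be the fast balancing parameter, i.e. for \omega \in \Omega, n_*(\omega) is the smallest n with b_1(n)(\omega) < \tau. Then for every n < n_{opt}: \mathbb{P}(n_* = n) \le c_1 \exp\big(-c_2 (n_{opt}-n)^2\big)\exp(\tau^2). -/
open MeasureTheory

/-- Contraction towards `x` gives geometric growth of the error when stepping backwards. -/
lemma norm_sub_le_pow_mul_of_contraction {H : Type*} [SeminormedAddCommGroup H]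
    {x : H} {xs : ℕ → H} {w : ℝ} (hw : 0 ≤ w)
    (hc : ∀ n, ‖x - xs (n + 1)‖ ≤ w * ‖x - xs n‖) (n m : ℕ) :
    ‖x - xs (n + m)‖ ≤ w ^ m * ‖x - xs n‖ := by
  induction m with
  | zero => simp
  | succ m ih =>
    calc ‖x - xs (n + (m + 1))‖ ≤ w * ‖x - xs (n + m)‖ := hc (n + m)
      _ ≤ w * (w ^ m * ‖x - xs n‖) := by gcongr
      _ = w ^ (m + 1) * ‖x - xs n‖ := by ring

/-- If `u + e` and `v + f` are close while `u` and `v` are far apart, one of the perturbations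
`e`, `f` is large. -/
lemma le_norm_or_le_norm_of_norm_add_sub_add_lt_s10 {H : Type*} [SeminormedAddCommGroup H]
    {u v e f : H} {r s t τ A : ℝ} (ht : 0 ≤ t) (hrs : r ≤ s)
    (hfar : 2 * A * s ≤ ‖u - v‖) (hclose : ‖(u + e) - (v + f)‖ < 4 * τ * s)
    (hA : t = A - 2 * τ) :
    t * r ≤ ‖e‖ ∨ t * s ≤ ‖f‖ := by
  by_contra! h
  have h1 : ‖u - v‖ ≤ ‖(u + e) - (v + f)‖ + ‖e‖ + ‖f‖ := by
    have h2 : u - v = (u + e) - (v + f) - e + f := by abel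
    calc ‖u - v‖ = ‖(u + e) - (v + f) - e + f‖ := by rw [← h2]
      _ ≤ ‖(u + e) - (v + f) - e‖ + ‖f‖ := norm_add_le _ _
      _ ≤ _ := by gcongr; exact norm_sub_le _ _
  have h3 : t * r ≤ t * s := by gcongr
  subst hA
  nlinarith [h.1, h.2]

/-- For every `w₁ ∈ (0,1)` there are constants `c₁, c₂ > 0`
depending only on `w₁` such that, in the stochastic balancing setup, the fast
balancing parameter `n_* = n_*(τ)` satisfies, for every `n < n_opt`,
`ℙ(n_* = n) ≤ c₁ exp(-c₂ (n_opt - n)²) exp(τ²)`. -/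
theorem fast_balancing_early_stop_bound
    (w1 : ℝ) (hw10 : 0 < w1) (hw11 : w1 < 1) :
    ∃ c1 c2 : ℝ, 0 < c1 ∧ 0 < c2 ∧
      ∀ (H : Type) [NormedAddCommGroup H] [InnerProductSpace ℝ H] [CompleteSpace H]
        [MeasurableSpace H] [BorelSpace H]
        (Ω : Type) [MeasurableSpace Ω] (P : Measure Ω) [IsProbabilityMeasure P]
        (x : H) (xs : ℕ → H) (η : ℕ → Ω → H) (ρ : ℕ → ℝ) (w2 : ℝ) (nopt : ℕ),
        (∀ n, 0 < ρ n) → 1 < w2 →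
        (∀ n, ‖x - xs (n + 1)‖ ≤ w1 * ‖x - xs n‖) →
        (∀ n, ρ n ≤ ρ (n + 1)) → (∀ n, ρ (n + 1) ≤ w2 * ρ n) →
        ρ nopt < ‖xs nopt - x‖ → ‖xs (nopt + 1) - x‖ ≤ ρ (nopt + 1) →
        (∀ n, Measurable (η n)) →
        (∀ n, ∀ t : ℝ, 0 < t →
          P {ω | t * ρ n ≤ ‖η n ω‖} ≤
            ENNReal.ofReal (Real.sqrt 2 * Real.exp (-t ^ 2 / 4))) →
        ∀ τ : ℝ, 0 ≤ τ → ∀ nstar : Ω → ℕ,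
        (∀ ω, IsLeast
          {n | ‖(xs n + η n ω) - (xs (n + 1) + η (n + 1) ω)‖ / (4 * ρ (n + 1)) < τ}
          (nstar ω)) →
        ∀ n, n < nopt →
          P {ω | nstar ω = n} ≤
            ENNReal.ofReal
              (c1 * Real.exp (-c2 * ((nopt : ℝ) - (n : ℝ)) ^ 2) * Real.exp (τ ^ 2)) := by
  have hq : 0 < 1 / w1 - 1 := by
    rw [sub_pos, lt_div_iff₀ hw10]; linarith
  have hB : 0 < (1 - w1) / 2 * (1 / w1 - 1) := mul_pos (by linarith) hq
  refine ⟨2 * Real.sqrt 2, ((1 - w1) / 2 * (1 / w1 - 1)) ^ 2 / 8, by positivity, by positivity, ?_⟩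
  intro H _ _ _ _ _ Ω _ P _ x xs η ρ w2 nopt hρ _ hc hmono _ hopt _ _ hη τ hτ nstar hstar n hn
  obtain ⟨m, rfl⟩ := Nat.exists_eq_add_of_lt hn
  set k := m + 1 with hk
  have hm : (((n + m + 1 : ℕ) : ℝ) - (n : ℝ)) = (k : ℝ) := by
    rw [hk]; push_cast; ring
  rw [hm]
  set A : ℝ := (1 - w1) / 2 * (1 / w1) ^ k with hAdef
  have hAk : (1 - w1) / 2 * (1 / w1 - 1) * k ≤ A := by
    have h1 : 1 + (k : ℝ) * (1 / w1 - 1) ≤ (1 + (1 / w1 - 1)) ^ k :=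
      one_add_mul_le_pow (by linarith) k
    rw [add_sub_cancel] at h1
    have h2 : (0 : ℝ) ≤ (1 - w1) / 2 := by linarith
    calc (1 - w1) / 2 * (1 / w1 - 1) * k = (1 - w1) / 2 * (k * (1 / w1 - 1)) := by ring
      _ ≤ A := by rw [hAdef]; gcongr; linarith
  have hA2 : ((1 - w1) / 2 * (1 / w1 - 1)) ^ 2 * (k : ℝ) ^ 2 ≤ A ^ 2 := by
    rw [← mul_pow]
    exact pow_le_pow_left₀ (by positivity) hAk 2
  have hA0 : 0 ≤ A := le_trans (by positivity) hAk
  have hsqrt : 1 ≤ Real.sqrt 2 := Real.one_le_sqrt.mpr (by norm_num)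
  rw [mul_assoc, ← Real.exp_add]
  rcases le_or_gt (A - 2 * τ) 0 with ht | ht
  · refine prob_le_one.trans (ENNReal.one_le_ofReal.mpr ?_)
    have h1 : 1 ≤ Real.exp (-(((1 - w1) / 2 * (1 / w1 - 1)) ^ 2 / 8) * (k : ℝ) ^ 2 + τ ^ 2) :=
      Real.one_le_exp (by nlinarith)
    nlinarith
  · have hfar : 2 * A * ρ (n + 1) ≤ ‖xs n - xs (n + 1)‖ := by
      have h1 : ‖x - xs n‖ ≤ ‖x - xs (n + 1)‖ + ‖xs n - xs (n + 1)‖ := by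
        rw [norm_sub_rev (xs n)]
        exact norm_sub_le_norm_sub_add_norm_sub _ _ _
      have h2 := norm_sub_le_pow_mul_of_contraction hw10.le hc n k
      have h3 : ρ (n + 1) ≤ ρ (n + k) := monotone_nat_of_le_succ hmono (by omega)
      have h4 : ρ (n + 1) ≤ w1 ^ k * ‖x - xs n‖ := by
        rw [norm_sub_rev] at hopt
        exact h3.trans (hopt.le.trans h2)
      have h5 : (1 / w1) ^ k * ρ (n + 1) ≤ ‖x - xs n‖ := by
        rw [one_div, inv_pow, inv_mul_le_iff₀ (by positivity)]
        exact h4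
      have h6 := mul_le_mul_of_nonneg_left h5 (by linarith : 0 ≤ 1 - w1)
      have h7 : 2 * A * ρ (n + 1) = (1 - w1) * ((1 / w1) ^ k * ρ (n + 1)) := by
        rw [hAdef]; ring
      linarith [hc n]
    have hsub : {ω | nstar ω = n} ⊆ {ω | (A - 2 * τ) * ρ n ≤ ‖η n ω‖} ∪
        {ω | (A - 2 * τ) * ρ (n + 1) ≤ ‖η (n + 1) ω‖} := by
      rintro ω rfl
      have h1 := (hstar ω).1
      rw [Set.mem_ofPred_eq, div_lt_iff₀ (by linarith [hρ (nstar ω + 1)])] at h1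
      exact le_norm_or_le_norm_of_norm_add_sub_add_lt_s10 ht.le (hmono _) hfar
        (by linarith) rfl
    refine (measure_mono hsub).trans ((measure_union_le _ _).trans
      ((add_le_add (hη n _ ht) (hη (n + 1) _ ht)).trans ?_))
    rw [← ENNReal.ofReal_add (by positivity) (by positivity), ← two_mul, ← mul_assoc]
    apply ENNReal.ofReal_le_ofReal
    gcongr
    nlinarith [sq_nonneg (A / 2 - 2 * τ)]
end

section
/- Under the stochastic balancing setup, for every \tau \ge 0 the probability that the fast balancing parameter stops late satisfies \mathbb{P}\big( n_*(\tau) \ge n_{opt} + 2 \big) \le \mathbb{P}\big( b_1(n_{opt}+1) \ge \tau \big) \le 2\sqrt{2}\, \exp(-\tau^2/4). In particular, for every n > n_{opt} one has \mathbb{P}(n_*(\tau) \in \{n_{opt}+2, \ldots, n\}) \le 2\sqrt{2}\exp(-\tau^2/4). -/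
open MeasureTheory

theorem measure_union_le_of_subgaussian_tail
    {H : Type*} [NormedAddCommGroup H] {Ω : Type*} [MeasurableSpace Ω] (P : Measure Ω)
    (η₁ η₂ : Ω → H) (r₁ r₂ : ℝ)
    (h₁ : ∀ t : ℝ, 0 < t → P {ω | t * r₁ ≤ ‖η₁ ω‖} ≤
      ENNReal.ofReal (Real.sqrt 2 * Real.exp (-t ^ 2 / 4)))
    (h₂ : ∀ t : ℝ, 0 < t → P {ω | t * r₂ ≤ ‖η₂ ω‖} ≤
      ENNReal.ofReal (Real.sqrt 2 * Real.exp (-t ^ 2 / 4)))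
    {t : ℝ} (ht : 0 < t) :
    P ({ω | t * r₁ ≤ ‖η₁ ω‖} ∪ {ω | t * r₂ ≤ ‖η₂ ω‖}) ≤
      ENNReal.ofReal (2 * Real.sqrt 2 * Real.exp (-t ^ 2 / 4)) := by
  calc _ ≤ _ := measure_union_le _ _
    _ ≤ _ := add_le_add (h₁ t ht) (h₂ t ht)
    _ = _ := by
      rw [← ENNReal.ofReal_add (by positivity) (by positivity)]
      ring_nf

theorem one_le_two_sqrt_two_mul_exp {t : ℝ} (h₀ : 0 ≤ t) (h₁ : t ≤ 1) :
    1 ≤ 2 * Real.sqrt 2 * Real.exp (-t ^ 2 / 4) := by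
  have hs : 1 ≤ Real.sqrt 2 := Real.one_le_sqrt.mpr one_le_two
  have he : 3 / 4 ≤ Real.exp (-t ^ 2 / 4) := by
    have := Real.add_one_le_exp (-t ^ 2 / 4)
    nlinarith
  nlinarith

theorem tail_event_of_le_norm_sub {H : Type*} [NormedAddCommGroup H]
    {x a b u v : H} {r s τ : ℝ} (hr : 0 < r) (hrs : r ≤ s) (hτ : 1 ≤ τ)
    (ha : ‖a - x‖ ≤ r) (hb : ‖x - b‖ ≤ r) (h : 4 * τ * s ≤ ‖(a + u) - (b + v)‖) :
    τ * r ≤ ‖u‖ ∨ τ * s ≤ ‖v‖ := by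
  by_contra! hlt
  have htri : ‖(a + u) - (b + v)‖ ≤ ‖a - x‖ + ‖x - b‖ + (‖u‖ + ‖v‖) := by
    calc _ = ‖((a - x) + (x - b)) + (u - v)‖ := by congr 1; abel
      _ ≤ _ := norm_add_le_of_le (norm_add_le _ _) (norm_sub_le _ _)
  nlinarith

/-- In the stochastic balancing setup, the probability that the
fast balancing parameter stops late satisfies
`ℙ(n_* ≥ n_opt + 2) ≤ ℙ(b₁(n_opt+1) ≥ τ) ≤ 2√2 exp(-τ²/4)`, and in particular
`ℙ(n_* ∈ {n_opt+2, …, n}) ≤ 2√2 exp(-τ²/4)` for every `n > n_opt`. -/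
theorem fast_balancing_late_stop_bound
    {H : Type*} [NormedAddCommGroup H] [InnerProductSpace ℝ H] [CompleteSpace H]
    [MeasurableSpace H] [BorelSpace H]
    {Ω : Type*} [MeasurableSpace Ω] (P : Measure Ω) [IsProbabilityMeasure P]
    (x : H) (xs : ℕ → H) (η : ℕ → Ω → H) (ρ : ℕ → ℝ) (hρpos : ∀ n, 0 < ρ n)
    (w1 w2 : ℝ) (hw10 : 0 < w1) (hw11 : w1 < 1) (hw2 : 1 < w2)
    (hdec : ∀ n, ‖x - xs (n + 1)‖ ≤ w1 * ‖x - xs n‖)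
    (hρmono : ∀ n, ρ n ≤ ρ (n + 1)) (hρgrow : ∀ n, ρ (n + 1) ≤ w2 * ρ n)
    (nopt : ℕ)
    (hopt1 : ρ nopt < ‖xs nopt - x‖)
    (hopt2 : ‖xs (nopt + 1) - x‖ ≤ ρ (nopt + 1))
    (hηmeas : ∀ n, Measurable (η n))
    (htail : ∀ n, ∀ t : ℝ, 0 < t →
      P {ω | t * ρ n ≤ ‖η n ω‖} ≤
        ENNReal.ofReal (Real.sqrt 2 * Real.exp (-t ^ 2 / 4)))
    (τ : ℝ) (hτ : 0 ≤ τ)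
    (nstar : Ω → ℕ)
    (hstar : ∀ ω, IsLeast
      {n | ‖(xs n + η n ω) - (xs (n + 1) + η (n + 1) ω)‖ / (4 * ρ (n + 1)) < τ}
      (nstar ω)) :
    P {ω | nopt + 2 ≤ nstar ω} ≤
      P {ω | 4 * τ * ρ (nopt + 2) ≤
        ‖(xs (nopt + 1) + η (nopt + 1) ω) - (xs (nopt + 2) + η (nopt + 2) ω)‖} ∧
    P {ω | 4 * τ * ρ (nopt + 2) ≤
        ‖(xs (nopt + 1) + η (nopt + 1) ω) - (xs (nopt + 2) + η (nopt + 2) ω)‖} ≤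
      ENNReal.ofReal (2 * Real.sqrt 2 * Real.exp (-τ ^ 2 / 4)) ∧
    ∀ n, nopt < n →
      P {ω | nstar ω ∈ Set.Icc (nopt + 2) n} ≤
        ENNReal.ofReal (2 * Real.sqrt 2 * Real.exp (-τ ^ 2 / 4)) := by
  have hlate : P {ω | nopt + 2 ≤ nstar ω} ≤
      P {ω | 4 * τ * ρ (nopt + 2) ≤
        ‖(xs (nopt + 1) + η (nopt + 1) ω) - (xs (nopt + 2) + η (nopt + 2) ω)‖} := by
    refine measure_mono fun ω (hω : nopt + 2 ≤ nstar ω) ↦ ?_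
    by_contra hlt
    have hpos := hρpos (nopt + 2)
    have hle : nstar ω ≤ nopt + 1 := (hstar ω).2 <| by
      simp only [Set.mem_ofPred_eq, not_le] at hlt ⊢
      rw [div_lt_iff₀ (by positivity)]
      linarith
    omega
  have htail_sub : P {ω | 4 * τ * ρ (nopt + 2) ≤
        ‖(xs (nopt + 1) + η (nopt + 1) ω) - (xs (nopt + 2) + η (nopt + 2) ω)‖} ≤
      ENNReal.ofReal (2 * Real.sqrt 2 * Real.exp (-τ ^ 2 / 4)) := by
    rcases le_total τ 1 with h | h
    · exact prob_le_one.trans (ENNReal.one_le_ofReal.mpr (one_le_two_sqrt_two_mul_exp hτ h))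
    · have hnext : ‖x - xs (nopt + 2)‖ ≤ ρ (nopt + 1) := by
        have h1 := hdec (nopt + 1)
        rw [norm_sub_rev x (xs (nopt + 1))] at h1
        exact h1.trans ((mul_le_of_le_one_left (norm_nonneg _) hw11.le).trans hopt2)
      exact (measure_mono fun ω hω ↦ tail_event_of_le_norm_sub (hρpos (nopt + 1))
        (hρmono (nopt + 1)) h hopt2 hnext hω).trans
        (measure_union_le_of_subgaussian_tail P _ _ _ _ (htail (nopt + 1))
          (htail (nopt + 2)) (one_pos.trans_le h))
  exact ⟨hlate, htail_sub, fun n _ ↦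
    (measure_mono fun ω hω ↦ hω.1).trans (hlate.trans htail_sub)⟩
end

section
/- Let H be a real Hilbert space, (\Omega,\mathcal{F},\mathbb{P}) a probability space, and \eta : \Omega \to H a strongly measurable random variable with \mathbb{E}\|\eta\|^4 < \infty, whose distribution is symmetric (\eta and -\eta have the same law), and which satisfies the fourth-moment bound \mathbb{E}\|\eta\|^4 \le K (\mathbb{E}\|\eta\|^2)^2 for some constant K \ge 1. Then for every v \in H: \mathbb{E}\|v + \eta\|^4 \le \max(K, 3)\, \big( \mathbb{E}\|v + \eta\|^2 \big)^2. (Moreover \mathbb{E}\|v+\eta\|^2 = \|v\|^2 + \mathbb{E}\|\eta\|^2.) -/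
open MeasureTheory

/-- The expectation of an odd function of a symmetrically distributed random variable vanishes. -/
theorem integral_odd_comp_eq_zero {H Ω : Type*} [NormedAddCommGroup H] [MeasurableSpace H]
    [BorelSpace H] [MeasurableSpace Ω] {P : Measure Ω} {η : Ω → H} (hη : Measurable η)
    (hsymm : Measure.map η P = Measure.map (fun ω => -η ω) P)
    {f : H → ℝ} (hf : Measurable f) (hodd : ∀ x, f (-x) = -f x) :
    ∫ ω, f (η ω) ∂P = 0 := by
  have h : ∫ ω, f (η ω) ∂P = ∫ ω, f (-η ω) ∂P := by
    rw [← integral_map hη.aemeasurable hf.aestronglyMeasurable, hsymm,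
      integral_map hη.fun_neg.aemeasurable hf.aestronglyMeasurable]
  simp only [hodd, integral_neg] at h
  linarith

/-- A random variable with finite fourth moment has finite `k`-th moment for every `k ≤ 4`. -/
theorem integrable_norm_pow_of_fourth_moment {H Ω : Type*} [NormedAddCommGroup H]
    [MeasurableSpace Ω] {P : Measure Ω} [IsFiniteMeasure P] {η : Ω → H}
    (hη : AEStronglyMeasurable η P) (hint : Integrable (fun ω => ‖η ω‖ ^ 4) P)
    {k : ℕ} (hk : k ≤ 4) : Integrable (fun ω => ‖η ω‖ ^ k) P := by
  refine ((integrable_const (1 : ℝ)).add hint).mono' (hη.norm.pow k) (.of_forall fun ω => ?_)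
  have h0 := norm_nonneg (η ω)
  simp only [norm_pow, norm_norm, Pi.add_apply]
  rcases le_total ‖η ω‖ 1 with h | h
  · linarith [pow_le_one₀ (n := k) h0 h, pow_nonneg h0 4]
  · linarith [pow_le_pow_right₀ h hk]

/-- If `η` is a symmetrically distributed `H`-valued random
variable with finite fourth moment satisfying `𝔼‖η‖⁴ ≤ K (𝔼‖η‖²)²`, then for every
`v ∈ H` one has `𝔼‖v + η‖⁴ ≤ max(K,3) (𝔼‖v + η‖²)²`, and moreover
`𝔼‖v + η‖² = ‖v‖² + 𝔼‖η‖²`. -/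
theorem fourth_moment_comparison_shifted
    {H : Type*} [NormedAddCommGroup H] [InnerProductSpace ℝ H] [CompleteSpace H]
    [MeasurableSpace H] [BorelSpace H]
    {Ω : Type*} [MeasurableSpace Ω] (P : Measure Ω) [IsProbabilityMeasure P]
    (η : Ω → H) (hmeas : StronglyMeasurable η)
    (hint : Integrable (fun ω => ‖η ω‖ ^ 4) P)
    (hsymm : Measure.map η P = Measure.map (fun ω => -η ω) P)
    (K : ℝ) (hK : 1 ≤ K)
    (hmom : ∫ ω, ‖η ω‖ ^ 4 ∂P ≤ K * (∫ ω, ‖η ω‖ ^ 2 ∂P) ^ 2) :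
    ∀ v : H,
      (∫ ω, ‖v + η ω‖ ^ 4 ∂P ≤ max K 3 * (∫ ω, ‖v + η ω‖ ^ 2 ∂P) ^ 2) ∧
      ∫ ω, ‖v + η ω‖ ^ 2 ∂P = ‖v‖ ^ 2 + ∫ ω, ‖η ω‖ ^ 2 ∂P := by
  intro v
  have hη : Measurable η := hmeas.measurable
  have hm : Measurable fun x : H => inner ℝ v x := by fun_prop
  have hYm : AEStronglyMeasurable (fun ω => inner ℝ v (η ω)) P :=
    (hm.comp hη).aestronglyMeasurable
  have hle (ω : Ω) : |inner ℝ v (η ω)| ≤ ‖v‖ * ‖η ω‖ := abs_real_inner_le_norm v (η ω)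
  have hpow {k : ℕ} (hk : k ≤ 4) : Integrable (fun ω => ‖η ω‖ ^ k) P :=
    integrable_norm_pow_of_fourth_moment hmeas.aestronglyMeasurable hint hk
  have hX : Integrable (fun ω => ‖η ω‖ ^ 2) P := hpow (by norm_num)
  have hY : Integrable (fun ω => inner ℝ v (η ω)) P := by
    refine ((hpow (k := 1) (by norm_num)).const_mul ‖v‖).mono' hYm (.of_forall fun ω => ?_)
    simpa using hle ω
  have hYX : Integrable (fun ω => inner ℝ v (η ω) * ‖η ω‖ ^ 2) P := by
    refine ((hpow (k := 3) (by norm_num)).const_mul ‖v‖).mono'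
      (hYm.mul hX.aestronglyMeasurable) (.of_forall fun ω => ?_)
    rw [norm_mul, Real.norm_eq_abs, norm_pow, norm_norm]
    calc |inner ℝ v (η ω)| * ‖η ω‖ ^ 2 ≤ (‖v‖ * ‖η ω‖) * ‖η ω‖ ^ 2 := by
          gcongr
          exact hle ω
      _ = ‖v‖ * ‖η ω‖ ^ 3 := by ring
  have hY0 : ∫ ω, inner ℝ v (η ω) ∂P = 0 :=
    integral_odd_comp_eq_zero hη hsymm hm fun x => inner_neg_right v x
  have hYX0 : ∫ ω, inner ℝ v (η ω) * ‖η ω‖ ^ 2 ∂P = 0 :=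
    integral_odd_comp_eq_zero (f := fun x => inner ℝ v x * ‖x‖ ^ 2) hη hsymm
      (hm.mul (measurable_norm.pow_const 2)) fun x => by simp
  have hsq (ω : Ω) : ‖v + η ω‖ ^ 2 = ‖v‖ ^ 2 + 2 * inner ℝ v (η ω) + ‖η ω‖ ^ 2 :=
    norm_add_sq_real v (η ω)
  have hsecond : ∫ ω, ‖v + η ω‖ ^ 2 ∂P = ‖v‖ ^ 2 + ∫ ω, ‖η ω‖ ^ 2 ∂P := by
    simp_rw [hsq]
    rw [integral_add (by fun_prop) hX, integral_add (by fun_prop) (hY.const_mul 2),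
      integral_const_mul, hY0]
    simp
  refine ⟨?_, hsecond⟩
  have hpt (ω : Ω) : ‖v + η ω‖ ^ 4 ≤ ‖v‖ ^ 4 + 6 * ‖v‖ ^ 2 * ‖η ω‖ ^ 2 + ‖η ω‖ ^ 4
      + 4 * ‖v‖ ^ 2 * inner ℝ v (η ω) + 4 * (inner ℝ v (η ω) * ‖η ω‖ ^ 2) := by
    have hcs : inner ℝ v (η ω) ^ 2 ≤ (‖v‖ * ‖η ω‖) ^ 2 :=
      sq_le_sq' (neg_le_of_abs_le (hle ω)) (le_of_abs_le (hle ω))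
    rw [show ‖v + η ω‖ ^ 4 = (‖v + η ω‖ ^ 2) ^ 2 by ring, hsq]
    linarith
  have hfourth : ∫ ω, ‖v + η ω‖ ^ 4 ∂P ≤
      ‖v‖ ^ 4 + 6 * ‖v‖ ^ 2 * (∫ ω, ‖η ω‖ ^ 2 ∂P) + ∫ ω, ‖η ω‖ ^ 4 ∂P := by
    refine (integral_mono_of_nonneg (.of_forall fun ω => by positivity) (by fun_prop)
      (.of_forall hpt)).trans_eq ?_
    rw [integral_add (by fun_prop) (by fun_prop), integral_add (by fun_prop) (by fun_prop),
      integral_add (by fun_prop) hint, integral_add (by fun_prop) (by fun_prop)]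
    simp only [integral_const_mul, hY0, hYX0]
    simp
  rw [hsecond]
  set m := ∫ ω, ‖η ω‖ ^ 2 ∂P
  have hm0 : 0 ≤ m := integral_nonneg fun ω => by positivity
  have h3 : 3 ≤ max K 3 := le_max_right K 3
  have hKm : K * m ^ 2 ≤ max K 3 * m ^ 2 := by
    gcongr
    exact le_max_left K 3
  have hv : ‖v‖ ^ 4 ≤ max K 3 * ‖v‖ ^ 4 := le_mul_of_one_le_left (by positivity) (by linarith)
  have hvm : 3 * (2 * ‖v‖ ^ 2 * m) ≤ max K 3 * (2 * ‖v‖ ^ 2 * m) := by gcongr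
  linarith
end
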